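/- For every n ≥ 1, the number of leaves after n steps of the restricted generating tree of weak-ordering chains with stopping condition x_{i1} < x_{i2} < x_{i3} (i1 < i2 < i3) equals Σ_{d=0}^{n−1} 2^d · e_{n,d} + Σ_{j=3}^{n} Σ_{d=0}^{j−3} 2^d · g_{j,d}. -/

import Mathlib

/-- A function `p : Fin n → Fin n` encodes an ordered set partition of `{1, …, n}`
when the set of values it attains is an initial segment of `Fin n`: `p i` is the
0-based index of the block containing `i` (so the 1-based position `pos(i)` of the
block containing `i` equals `p i + 1`, and comparisons between `pos` values
correspond to comparisons between values of `p`). -/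
def IsOSP {n : ℕ} (p : Fin n → Fin n) : Prop :=
  ∀ i v, v ≤ p i → ∃ j, p j = v

/-- The number of descents of a permutation `σ` of `Fin n`:
positions `i` (0-based) with `σ (i+1) < σ i`. -/
noncomputable def descents {n : ℕ} (σ : Equiv.Perm (Fin n)) : ℕ :=
  Nat.card {q : Fin n × Fin n // q.1.val + 1 = q.2.val ∧ σ q.2 < σ q.1}

/-- `σ` contains the pattern 123. -/
def Contains123 {n : ℕ} (σ : Equiv.Perm (Fin n)) : Prop :=
  ∃ i j k : Fin n, i < j ∧ j < k ∧ σ i < σ j ∧ σ j < σ k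

/-- The reduction of `σ` (obtained by deleting the largest entry from the
one-line notation of `σ`) avoids the pattern 123; equivalently, `σ` has no
occurrence of 123 using only entries different from the maximum value
(in an occurrence `σ i < σ j < σ k` only `σ k` can be the maximum). -/
def ReductionAvoids123 {n : ℕ} (σ : Equiv.Perm (Fin n)) : Prop :=
  ¬ ∃ i j k : Fin n, i < j ∧ j < k ∧ σ i < σ j ∧ σ j < σ k ∧ ∃ l, σ k < σ l

/-- `e123 n d` is the number of 123-avoiding permutations of `[n]` with exactly `d` descents. -/
noncomputable def e123 (n d : ℕ) : ℕ :=
  Nat.card {σ : Equiv.Perm (Fin n) // ¬ Contains123 σ ∧ descents σ = d}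

/-- `g123 n d` is the number of permutations of `[n]` that contain the pattern 123,
have exactly `d` descents, and whose reduction (deleting the entry `n`) avoids 123. -/
noncomputable def g123 (n d : ℕ) : ℕ :=
  Nat.card {σ : Equiv.Perm (Fin n) //
    Contains123 σ ∧ descents σ = d ∧ ReductionAvoids123 σ}

/-- The ordered set partition encoded by `p` contains the condition
`x_{i1} < x_{i2} < x_{i3}` with `i1 < i2 < i3`. -/
def Chain123 {n : ℕ} (p : Fin n → Fin n) : Prop :=
  ∃ i j k : Fin n, i < j ∧ j < k ∧ p i < p j ∧ p j < p k

/- Deleting the element `n` from an ordered set partition of `[n]` preserves block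
membership and the relative order of the blocks of the remaining elements, so the
restriction to `[n-1]` contains a given stopping condition iff the condition occurs
with all of its witnesses among the elements of `[n-1]`, i.e. among the indices `i`
with `i.val < n - 1`. -/

/-- `σ` lists the elements block by block along `p`, each block in decreasing order. -/
def ListsBlocks {n : ℕ} (p : Fin n → Fin n) (σ : Equiv.Perm (Fin n)) : Prop :=
  ∀ a b, a < b → p (σ a) < p (σ b) ∨ (p (σ a) = p (σ b) ∧ σ b < σ a)

/-- The sorting key: by block, then by decreasing element. -/
def blockKey {n : ℕ} (p : Fin n → Fin n) (i : Fin n) : Fin n ×ₗ (Fin n)ᵒᵈ :=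
  toLex (p i, OrderDual.toDual i)

theorem listsBlocks_iff_strictMono {n : ℕ} {p : Fin n → Fin n} {σ : Equiv.Perm (Fin n)} :
    ListsBlocks p σ ↔ StrictMono (blockKey p ∘ σ) := by
  simp [ListsBlocks, StrictMono, blockKey, Prod.Lex.toLex_lt_toLex]

theorem blockKey_injective {n : ℕ} (p : Fin n → Fin n) : Function.Injective (blockKey p) := by
  intro a b h
  have := congrArg (fun x => OrderDual.ofDual (ofLex x).2) h
  simpa [blockKey] using this

/-- The permutation listing the blocks of `p` in order, each in decreasing order. -/
def listing {n : ℕ} (p : Fin n → Fin n) : Equiv.Perm (Fin n) := Tuple.sort (blockKey p)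

theorem listing_eq_iff {n : ℕ} {p : Fin n → Fin n} {σ : Equiv.Perm (Fin n)} :
    listing p = σ ↔ ListsBlocks p σ := by
  have key : StrictMono (blockKey p ∘ listing p) :=
    (Tuple.monotone_sort (blockKey p)).strictMono_of_injective
      ((blockKey_injective p).comp (listing p).injective)
  rw [listsBlocks_iff_strictMono]
  constructor
  · rintro rfl
    exact key
  · intro h
    have := Tuple.unique_monotone key.monotone h.monotone
    ext i
    exact congrArg Fin.val (blockKey_injective p (congrFun this i))

theorem ListsBlocks.le {n : ℕ} {p : Fin n → Fin n} {σ : Equiv.Perm (Fin n)}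
    (h : ListsBlocks p σ) {a b : Fin n} (hab : a ≤ b) : p (σ a) ≤ p (σ b) := by
  rcases hab.eq_or_lt with rfl | hab
  · exact le_rfl
  · rcases h a b hab with h | h
    · exact h.le
    · exact h.1.le

theorem ListsBlocks.lt_of_lt {n : ℕ} {p : Fin n → Fin n} {σ : Equiv.Perm (Fin n)}
    (h : ListsBlocks p σ) {a b : Fin n} (hab : p (σ a) < p (σ b)) : a < b := by
  by_contra! hba
  exact absurd (h.le hba) (not_le.2 hab)

theorem ListsBlocks.lt_of_ascent {n : ℕ} {p : Fin n → Fin n} {σ : Equiv.Perm (Fin n)}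
    (h : ListsBlocks p σ) {a b : Fin n} (hab : a < b) (hσ : σ a < σ b) :
    p (σ a) < p (σ b) := by
  rcases h a b hab with h | h
  · exact h
  · exact absurd h.2 hσ.asymm

theorem ListsBlocks.chain123_iff {n : ℕ} {p : Fin n → Fin n} {σ : Equiv.Perm (Fin n)}
    (h : ListsBlocks p σ) : Chain123 p ↔ Contains123 σ := by
  constructor
  · rintro ⟨a, b, c, hab, hbc, pab, pbc⟩
    obtain ⟨i, rfl⟩ := σ.surjective a
    obtain ⟨j, rfl⟩ := σ.surjective b
    obtain ⟨k, rfl⟩ := σ.surjective c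
    exact ⟨i, j, k, h.lt_of_lt pab, h.lt_of_lt pbc, hab, hbc⟩
  · rintro ⟨i, j, k, hij, hjk, sij, sjk⟩
    exact ⟨σ i, σ j, σ k, sij, sjk, h.lt_of_ascent hij sij, h.lt_of_ascent hjk sjk⟩

theorem ListsBlocks.restriction_avoids_iff {n : ℕ} {p : Fin n → Fin n}
    {σ : Equiv.Perm (Fin n)} (h : ListsBlocks p σ) :
    (¬ ∃ a b c : Fin n, a.val < n - 1 ∧ b.val < n - 1 ∧ c.val < n - 1 ∧
      a < b ∧ b < c ∧ p a < p b ∧ p b < p c) ↔ ReductionAvoids123 σ := by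
  refine not_congr ⟨?_, ?_⟩
  · rintro ⟨a, b, c, -, -, hc, hab, hbc, pab, pbc⟩
    obtain ⟨i, rfl⟩ := σ.surjective a
    obtain ⟨j, rfl⟩ := σ.surjective b
    obtain ⟨k, rfl⟩ := σ.surjective c
    obtain ⟨l, hl⟩ := σ.surjective ⟨n - 1, by omega⟩
    exact ⟨i, j, k, h.lt_of_lt pab, h.lt_of_lt pbc, hab, hbc, l, by rw [hl]; exact hc⟩
  · rintro ⟨i, j, k, hij, hjk, sij, sjk, l, hl⟩
    refine ⟨σ i, σ j, σ k, ?_, ?_, ?_, sij, sjk, h.lt_of_ascent hij sij, h.lt_of_ascent hjk sjk⟩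
    all_goals
      simp only [Fin.lt_def] at *
      omega

theorem ListsBlocks.le_add_one {n : ℕ} {p : Fin n → Fin n} {σ : Equiv.Perm (Fin n)}
    (h : ListsBlocks p σ) (hp : IsOSP p) {a b : Fin n} (hab : a.val + 1 = b.val) :
    (p (σ b)).val ≤ (p (σ a)).val + 1 := by
  by_contra! hlt
  obtain ⟨m, hm⟩ := hp (σ b) ⟨(p (σ a)).val + 1, by omega⟩ (Fin.le_def.2 hlt.le)
  obtain ⟨m, rfl⟩ := σ.surjective m
  have h1 : a < m := h.lt_of_lt (by rw [hm, Fin.lt_def]; simp)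
  have h2 : m < b := h.lt_of_lt (by rw [hm, Fin.lt_def]; exact hlt)
  simp only [Fin.lt_def] at h1 h2
  omega

theorem ListsBlocks.apply_zero {n : ℕ} {p : Fin n → Fin n} {σ : Equiv.Perm (Fin n)}
    (h : ListsBlocks p σ) (hp : IsOSP p) (h0 : 0 < n) : (p (σ ⟨0, h0⟩)).val = 0 := by
  obtain ⟨m, hm⟩ := hp (σ ⟨0, h0⟩) ⟨0, h0⟩ (Fin.le_def.2 (Nat.zero_le _))
  obtain ⟨m, rfl⟩ := σ.surjective m
  have := h.le (a := ⟨0, h0⟩) (b := m) (Fin.le_def.2 (Nat.zero_le _))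
  rw [hm, Fin.le_def] at this
  simpa using this

/-- Pairs of consecutive positions forming a descent. -/
abbrev DescentPair {n : ℕ} (σ : Equiv.Perm (Fin n)) : Type :=
  {q : Fin n × Fin n // q.1.val + 1 = q.2.val ∧ σ q.2 < σ q.1}

/-- The descents of `σ` at which a new block of `p` starts. -/
def cutDescents {n : ℕ} (σ : Equiv.Perm (Fin n)) (p : Fin n → Fin n) : Set (DescentPair σ) :=
  {q | p (σ q.1.1) < p (σ q.1.2)}

theorem ListsBlocks.ext {n : ℕ} {p p' : Fin n → Fin n} {σ : Equiv.Perm (Fin n)}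
    (h : ListsBlocks p σ) (hp : IsOSP p) (h' : ListsBlocks p' σ) (hp' : IsOSP p')
    (hcut : cutDescents σ p = cutDescents σ p') : p = p' := by
  suffices H : ∀ (m : ℕ) (hm : m < n), (p (σ ⟨m, hm⟩)).val = (p' (σ ⟨m, hm⟩)).val by
    funext x
    obtain ⟨i, rfl⟩ := σ.surjective x
    exact Fin.ext (H i.1 i.2)
  intro m
  induction m with
  | zero => intro hm; rw [h.apply_zero hp, h'.apply_zero hp']
  | succ m ih =>
    intro hm
    have hm' : m < n := by omega
    have e := ih hm'
    have s := h.le_add_one hp (a := ⟨m, hm'⟩) (b := ⟨m + 1, hm⟩) rfl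
    have s' := h'.le_add_one hp' (a := ⟨m, hm'⟩) (b := ⟨m + 1, hm⟩) rfl
    have hlt : (⟨m, hm'⟩ : Fin n) < ⟨m + 1, hm⟩ := Fin.lt_def.2 (Nat.lt_succ_self m)
    have l := h.le hlt.le
    have l' := h'.le hlt.le
    have iff : p (σ ⟨m, hm'⟩) < p (σ ⟨m + 1, hm⟩) ↔ p' (σ ⟨m, hm'⟩) < p' (σ ⟨m + 1, hm⟩) := by
      rcases lt_or_gt_of_ne (σ.injective.ne hlt.ne) with hs | hs
      · exact iff_of_true (h.lt_of_ascent hlt hs) (h'.lt_of_ascent hlt hs)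
      · exact Set.ext_iff.1 hcut ⟨(⟨m, hm'⟩, ⟨m + 1, hm⟩), rfl, hs⟩
    simp only [Fin.lt_def, Fin.le_def] at iff l l'
    omega

/-- A block starts at position `k > 0`: there is an ascent into `k`, or a selected descent. -/
def IsCut {n : ℕ} (σ : Equiv.Perm (Fin n)) (S : Set (DescentPair σ)) (k : Fin n) : Prop :=
  ∃ j : Fin n, j.val + 1 = k.val ∧ (σ j < σ k ∨ ∃ q ∈ S, q.1 = (j, k))

open Classical in
/-- The number of cuts at positions at most `i`. -/
noncomputable def cutCount {n : ℕ} (σ : Equiv.Perm (Fin n)) (S : Set (DescentPair σ))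
    (i : Fin n) : Fin n :=
  ⟨(Finset.univ.filter fun k => k ≤ i ∧ IsCut σ S k).card, by
    have h0 : 0 < n := i.pos
    have : (⟨0, h0⟩ : Fin n) ∉ Finset.univ.filter fun k => k ≤ i ∧ IsCut σ S k := by
      simp [IsCut]
    simpa using Finset.card_lt_univ_of_notMem this⟩

theorem cutCount_zero {n : ℕ} (σ : Equiv.Perm (Fin n)) (S : Set (DescentPair σ)) (h0 : 0 < n) :
    (cutCount σ S ⟨0, h0⟩).val = 0 := by
  classical
  simp only [cutCount, Finset.card_eq_zero, Finset.filter_eq_empty_iff]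
  rintro k - ⟨hk, j, hj, -⟩
  simp only [Fin.le_def] at hk
  omega

open Classical in
theorem cutCount_succ {n : ℕ} (σ : Equiv.Perm (Fin n)) (S : Set (DescentPair σ)) {a b : Fin n}
    (hab : a.val + 1 = b.val) :
    (cutCount σ S b).val = (cutCount σ S a).val + if IsCut σ S b then 1 else 0 := by
  simp only [cutCount]
  split_ifs with hb
  · rw [← Finset.card_insert_of_notMem (a := b)]
    · congr 1
      ext k
      simp only [Finset.mem_filter, Finset.mem_univ, true_and, Finset.mem_insert, Fin.le_def,
        Fin.ext_iff]
      constructor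
      · rintro ⟨h1, h2⟩
        by_cases hk : k.val = b.val
        · exact Or.inl hk
        · exact Or.inr ⟨by omega, h2⟩
      · rintro (h1 | ⟨h1, h2⟩)
        · exact ⟨h1.le, Fin.ext h1 ▸ hb⟩
        · exact ⟨by omega, h2⟩
    · simp only [Finset.mem_filter, Fin.le_def]
      omega
  · rw [add_zero]
    congr 1
    ext k
    simp only [Finset.mem_filter, Finset.mem_univ, true_and, Fin.le_def]
    refine and_congr_left fun hk => ?_
    have : k.val ≠ b.val := fun e => hb (Fin.ext e ▸ hk)
    omega

theorem isCut_iff_mem {n : ℕ} {σ : Equiv.Perm (Fin n)} {S : Set (DescentPair σ)}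
    (q : DescentPair σ) : IsCut σ S q.1.2 ↔ q ∈ S := by
  constructor
  · rintro ⟨j, hj, h⟩
    have hj' : j = q.1.1 := Fin.ext (by have := q.2.1; omega)
    subst hj'
    rcases h with h | ⟨q', hq', e⟩
    · exact absurd q.2.2 h.asymm
    · rwa [← Subtype.ext (show q'.1 = q.1 from e)]
  · intro h
    exact ⟨q.1.1, q.2.1, Or.inr ⟨q, h, rfl⟩⟩

theorem listsBlocks_cutCount {n : ℕ} (σ : Equiv.Perm (Fin n)) (S : Set (DescentPair σ)) :
    ListsBlocks (cutCount σ S ∘ σ.symm) σ := by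
  classical
  suffices H : ∀ (m : ℕ) (a b : Fin n), a.val + m + 1 = b.val →
      cutCount σ S a < cutCount σ S b ∨ (cutCount σ S a = cutCount σ S b ∧ σ b < σ a) by
    intro a b hab
    simpa using H (b.val - a.val - 1) a b (by simp only [Fin.lt_def] at hab; omega)
  have step : ∀ a b : Fin n, a.val + 1 = b.val →
      cutCount σ S a < cutCount σ S b ∨ (cutCount σ S a = cutCount σ S b ∧ σ b < σ a) := by
    intro a b hab
    have h := cutCount_succ σ S hab
    by_cases hb : IsCut σ S b
    · left
      rw [if_pos hb] at h
      exact Fin.lt_def.2 (by omega)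
    · right
      rw [if_neg hb, add_zero] at h
      refine ⟨Fin.ext h.symm, lt_of_le_of_ne (not_lt.1 fun hs => hb ⟨a, hab, Or.inl hs⟩) ?_⟩
      intro e
      have := congrArg Fin.val (σ.injective e)
      omega
  intro m
  induction m with
  | zero => exact step
  | succ m ih =>
    intro a b hab
    have hc : a.val + m + 1 < n := by omega
    have h1 := ih a ⟨a.val + m + 1, hc⟩ rfl
    have h2 := step ⟨a.val + m + 1, hc⟩ b (by simp only; omega)
    rcases h1 with h1 | ⟨h1, h1'⟩ <;> rcases h2 with h2 | ⟨h2, h2'⟩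
    · exact Or.inl (h1.trans h2)
    · exact Or.inl (h2 ▸ h1)
    · exact Or.inl (h1 ▸ h2)
    · exact Or.inr ⟨h1.trans h2, h2'.trans h1'⟩

theorem isOSP_cutCount {n : ℕ} (σ : Equiv.Perm (Fin n)) (S : Set (DescentPair σ)) :
    IsOSP (cutCount σ S ∘ σ.symm) := by
  classical
  suffices H : ∀ (m : ℕ) (hm : m < n) (v : Fin n), v ≤ cutCount σ S ⟨m, hm⟩ →
      ∃ j, cutCount σ S j = v by
    intro i v hv
    obtain ⟨j, hj⟩ := H _ (σ.symm i).2 v hv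
    exact ⟨σ j, by simpa using hj⟩
  intro m
  induction m with
  | zero =>
    intro hm v hv
    refine ⟨_, le_antisymm ?_ hv⟩
    rw [Fin.le_def, cutCount_zero]
    exact Nat.zero_le _
  | succ m ih =>
    intro hm v hv
    by_cases h : v ≤ cutCount σ S ⟨m, by omega⟩
    · exact ih _ v h
    · refine ⟨_, le_antisymm ?_ hv⟩
      have := cutCount_succ σ S (a := ⟨m, by omega⟩) (b := ⟨m + 1, hm⟩) rfl
      simp only [Fin.le_def] at *
      split_ifs at this <;> omega

theorem cutDescents_cutCount {n : ℕ} (σ : Equiv.Perm (Fin n)) (S : Set (DescentPair σ)) :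
    cutDescents σ (cutCount σ S ∘ σ.symm) = S := by
  classical
  ext q
  have h := cutCount_succ σ S q.2.1
  rw [← isCut_iff_mem (S := S) q]
  change cutCount σ S (σ.symm (σ q.1.1)) < cutCount σ S (σ.symm (σ q.1.2)) ↔ _
  rw [Equiv.symm_apply_apply, Equiv.symm_apply_apply, Fin.lt_def, h]
  split_ifs with hc <;> simp [hc]

theorem card_isOSP_listsBlocks {n : ℕ} (σ : Equiv.Perm (Fin n)) :
    Nat.card {p : Fin n → Fin n // IsOSP p ∧ ListsBlocks p σ} = 2 ^ descents σ := by
  have e : Function.Bijective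
      (fun p : {p : Fin n → Fin n // IsOSP p ∧ ListsBlocks p σ} => cutDescents σ p.1) :=
    ⟨fun p p' h => Subtype.ext (p.2.2.ext p.2.1 p'.2.2 p'.2.1 h),
      fun S => ⟨⟨_, isOSP_cutCount σ S, listsBlocks_cutCount σ S⟩, cutDescents_cutCount σ S⟩⟩
  rw [Nat.card_eq_of_bijective _ e, descents]
  classical
  simp [Nat.card_eq_fintype_card, Fintype.card_set]

theorem descents_le_card {n : ℕ} (σ : Equiv.Perm (Fin n)) (T : Finset ℕ)
    (hT : ∀ q : DescentPair σ, q.1.1.val ∈ T) : descents σ ≤ T.card := by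
  have inj : Function.Injective
      (fun q : DescentPair σ => (⟨q.1.1.val, hT q⟩ : T)) := by
    intro q q' h
    have h1 : q.1.1.val = q'.1.1.val := congrArg Subtype.val h
    have := q.2.1
    have := q'.2.1
    exact Subtype.ext (Prod.ext (Fin.ext h1) (Fin.ext (by omega)))
  simpa [descents] using Nat.card_le_card_of_injective _ inj

theorem descents_lt {n : ℕ} (hn : 1 ≤ n) (σ : Equiv.Perm (Fin n)) : descents σ < n := by
  have := descents_le_card σ (Finset.range (n - 1)) fun q => by
    have := q.2.1
    have := q.1.2.2
    simp only [Finset.mem_range]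
    omega
  rw [Finset.card_range] at this
  omega

theorem exists_ascent {n : ℕ} {σ : Equiv.Perm (Fin n)} {i j : Fin n} (hij : i < j)
    (hσ : σ i < σ j) :
    ∃ a b : Fin n, a.val + 1 = b.val ∧ i ≤ a ∧ a < j ∧ σ a < σ b := by
  by_contra! H
  have : ∀ m (hm : m < n), i.val ≤ m → m ≤ j.val → σ ⟨m, hm⟩ ≤ σ i := by
    intro m hm him
    induction m, him using Nat.le_induction with
    | base => intro _; exact le_rfl
    | succ m him ih =>
      intro hmj
      exact (H ⟨m, by omega⟩ ⟨m + 1, hm⟩ rfl (Fin.le_def.2 him) (Fin.lt_def.2 hmj)).trans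
        (ih (by omega) (by omega))
  exact absurd hσ (not_lt.2 (this j.1 j.2 (Fin.lt_def.1 hij).le le_rfl))

theorem Contains123.descents_add_three_le {n : ℕ} {σ : Equiv.Perm (Fin n)}
    (h : Contains123 σ) : descents σ + 3 ≤ n := by
  obtain ⟨i, j, k, hij, hjk, sij, sjk⟩ := h
  obtain ⟨a, b, hab, -, haj, sab⟩ := exists_ascent hij sij
  obtain ⟨c, d, hcd, hjc, hck, scd⟩ := exists_ascent hjk sjk
  have ne {x y : Fin n} (hxy : x.val + 1 = y.val) (s : σ x < σ y) (q : DescentPair σ) :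
      q.1.1.val ≠ x.val := by
    intro e
    have e1 : q.1.1 = x := Fin.ext e
    have e2 : q.1.2 = y := Fin.ext (by have := q.2.1; omega)
    have := q.2.2
    rw [e1, e2] at this
    exact this.asymm s
  have hle := descents_le_card σ (((Finset.range (n - 1)).erase a.val).erase c.val) fun q => by
    have := q.2.1
    have := q.1.2.2
    simp only [Finset.mem_erase, Finset.mem_range]
    exact ⟨ne hcd scd q, ne hab sab q, by omega⟩
  simp only [Fin.lt_def, Fin.le_def] at *
  have := b.2
  have := d.2
  rw [Finset.card_erase_of_mem, Finset.card_erase_of_mem, Finset.card_range] at hle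
  · omega
  · simp only [Finset.mem_range]; omega
  · simp only [Finset.mem_erase, Finset.mem_range]; omega

/-- A property of ordered set partitions that only depends on the listing permutation is counted
by the permutations satisfying it, each weighted by `2 ^ descents`. -/
theorem card_isOSP_eq_sum {n : ℕ} (hn : 1 ≤ n) (P : (Fin n → Fin n) → Prop)
    (Q : Equiv.Perm (Fin n) → Prop) (hPQ : ∀ p σ, ListsBlocks p σ → (P p ↔ Q σ)) :
    Nat.card {p : Fin n → Fin n // IsOSP p ∧ P p} =
      ∑ d ∈ Finset.range n, 2 ^ d * Nat.card {σ : Equiv.Perm (Fin n) // Q σ ∧ descents σ = d} := by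
  classical
  have hfib (σ : Equiv.Perm (Fin n)) (hσ : Q σ) :
      ((Finset.univ.filter fun p : Fin n → Fin n => IsOSP p ∧ P p).filter
        fun p => listing p = σ).card = 2 ^ descents σ := by
    rw [← card_isOSP_listsBlocks σ, Nat.card_eq_fintype_card, Fintype.card_subtype,
      Finset.filter_filter]
    congr 1
    refine Finset.filter_congr fun p _ => ?_
    rw [listing_eq_iff]
    constructor
    · exact fun h => ⟨h.1.1, h.2⟩
    · exact fun h => ⟨⟨h.1, (hPQ p σ h.2).2 hσ⟩, h.2⟩
  rw [Nat.card_eq_fintype_card, Fintype.card_subtype,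
    Finset.card_eq_sum_card_fiberwise (f := listing) (t := Finset.univ.filter Q),
    Finset.sum_congr rfl fun σ hσ => hfib σ (Finset.mem_filter.1 hσ).2,
    ← Finset.sum_fiberwise_of_maps_to (g := descents) (t := Finset.range n)]
  · refine Finset.sum_congr rfl fun d _ => ?_
    rw [Finset.sum_congr rfl fun σ hσ => by rw [(Finset.mem_filter.1 hσ).2],
      Finset.sum_const, Finset.filter_filter, Nat.card_eq_fintype_card, Fintype.card_subtype,
      smul_eq_mul, mul_comm]
  · exact fun σ _ => Finset.mem_range.2 (descents_lt hn σ)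
  · intro p hp
    simp only [Finset.coe_filter, Finset.mem_univ, true_and, Set.mem_ofPred_eq] at hp ⊢
    exact (hPQ p _ (listing_eq_iff.1 rfl)).1 hp.2

theorem g123_eq_zero {n d : ℕ} (h : n < d + 3) : g123 n d = 0 := by
  rw [g123, Nat.card_eq_zero]
  left
  refine ⟨fun σ => ?_⟩
  have h1 := σ.2.1.descents_add_three_le
  have h2 := σ.2.2.1
  omega

theorem card_stopping_eq_sum {n : ℕ} (hn : 1 ≤ n) :
    Nat.card {p : Fin n → Fin n // IsOSP p ∧ Chain123 p ∧
        ¬ ∃ a b c : Fin n, a.val < n - 1 ∧ b.val < n - 1 ∧ c.val < n - 1 ∧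
          a < b ∧ b < c ∧ p a < p b ∧ p b < p c} =
      ∑ d ∈ Finset.range (n - 2), 2 ^ d * g123 n d := by
  rw [card_isOSP_eq_sum hn _ (fun σ => Contains123 σ ∧ ReductionAvoids123 σ)
    fun p σ h => and_congr h.chain123_iff h.restriction_avoids_iff]
  rw [Finset.sum_subset (Finset.range_mono (Nat.sub_le n 2))]
  · refine Finset.sum_congr rfl fun d _ => ?_
    rw [g123]
    congr 1
    exact Nat.card_congr (Equiv.subtypeEquivRight fun σ => by tauto)
  · intro d _ hd
    rw [g123_eq_zero (by rw [Finset.mem_range] at hd; omega), mul_zero]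

/-- Stopping condition `x_{i1} < x_{i2} < x_{i3}` (`i1 < i2 < i3`): the number of
leaves after `n` steps equals
`Σ_{d=0}^{n-1} 2^d e_{n,d} + Σ_{j=3}^{n} Σ_{d=0}^{j-3} 2^d g_{j,d}`. -/
theorem woc_stop_123 (n : ℕ) (hn : 1 ≤ n) :
    Nat.card {p : Fin n → Fin n // IsOSP p ∧ ¬ Chain123 p} +
      ∑ j ∈ Finset.Icc 1 n,
        Nat.card {p : Fin j → Fin j // IsOSP p ∧ Chain123 p ∧
          ¬ ∃ a b c : Fin j, a.val < j - 1 ∧ b.val < j - 1 ∧ c.val < j - 1 ∧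
            a < b ∧ b < c ∧ p a < p b ∧ p b < p c}
      = ∑ d ∈ Finset.range n, 2 ^ d * e123 n d
        + ∑ j ∈ Finset.Icc 3 n, ∑ d ∈ Finset.range (j - 2), 2 ^ d * g123 j d := by
  rw [card_isOSP_eq_sum hn (fun p => ¬ Chain123 p) (fun σ => ¬ Contains123 σ)
    fun p σ h => not_congr h.chain123_iff,
    Finset.sum_congr rfl fun j hj => card_stopping_eq_sum (Finset.mem_Icc.1 hj).1]
  congr 1
  refine (Finset.sum_subset (Finset.Icc_subset_Icc_left (by norm_num)) fun j hj hj' => ?_).symm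
  rw [Finset.mem_Icc] at hj hj'
  rw [show j - 2 = 0 by omega, Finset.sum_range_zero]
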